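/- arXiv:1407.7998 — 2 statements merged into one kernel-verified Lean document; each statement's English description precedes it below -/
import Mathlib

section
/- Let J be an instance in which all jobs have equal processing times, i.e., p_j = p for all j ∈ J, and suppose J admits a feasible preemptive schedule on m machines. Then the EDF schedule of J on 3m machines completes every job by its deadline. -/
/-- A job with release date `r`, deadline `d`, and processing time `p`. -/
structure Job where
  r : ℕ
  d : ℕ
  p : ℕ

/-- A job is valid if `1 ≤ p` and `p ≤ d - r` (i.e. `r + p ≤ d`). -/
def Job.valid (j : Job) : Prop := 1 ≤ j.p ∧ j.r + j.p ≤ j.d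

/-- The laxity `ℓ_j = d_j - r_j - p_j` of a job. -/
def Job.lax (j : Job) : ℕ := j.d - j.r - j.p

/-- A preemptive schedule of the instance `J` is feasible on `m` machines if at most `m`
jobs are processed in every slot, every job is only processed inside its window, and
every job is processed for exactly `p_j` slots. -/
def FeasiblePre {n : ℕ} (J : Fin n → Job) (m : ℕ) : Prop :=
  ∃ S : ℕ → Finset (Fin n),
    (∀ t, (S t).card ≤ m) ∧
    (∀ t j, j ∈ S t → (J j).r ≤ t ∧ t < (J j).d) ∧
    (∀ j, ((Finset.range (J j).d).filter (fun t => j ∈ S t)).card = (J j).p)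

/-- The minimum number of machines on which `J` admits a feasible preemptive schedule. -/
noncomputable def mOpt {n : ℕ} (J : Fin n → Job) : ℕ := sInf {m | FeasiblePre J m}

/-- From the set `A`, select the (at most) `m'` smallest elements w.r.t. the
(irreflexive, total) order `lt`. -/
def select {n : ℕ} (m' : ℕ) (lt : Fin n → Fin n → Prop) [DecidableRel lt]
    (A : Finset (Fin n)) : Finset (Fin n) :=
  A.filter (fun j => (A.filter fun k => lt k j).card < m')

/-- EDF priority: smaller deadline first, ties broken by earlier release date,
then by lower index. -/
def edfLt {n : ℕ} (J : Fin n → Job) (a b : Fin n) : Prop :=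
  (J a).d < (J b).d ∨
    ((J a).d = (J b).d ∧
      ((J a).r < (J b).r ∨ ((J a).r = (J b).r ∧ a < b)))

instance {n : ℕ} (J : Fin n → Job) : DecidableRel (edfLt J) := fun a b => by
  unfold edfLt; infer_instance

/-- The set of active jobs at time `t`, given that job `j` has been processed for
`c j` slots so far: released and not yet finished. -/
def activeSet {n : ℕ} (J : Fin n → Job) (c : Fin n → ℕ) (t : ℕ) : Finset (Fin n) :=
  Finset.univ.filter (fun j => (J j).r ≤ t ∧ c j < (J j).p)

/-- `edfCnt J m' t j` is the number of slots before time `t` in which the EDF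
schedule on `m'` machines processes job `j`. -/
def edfCnt {n : ℕ} (J : Fin n → Job) (m' : ℕ) : ℕ → Fin n → ℕ
  | 0 => fun _ => 0
  | t + 1 => fun j =>
      edfCnt J m' t j +
        (if j ∈ select m' (edfLt J) (activeSet J (edfCnt J m' t) t) then 1 else 0)

/-- The set of jobs processed in slot `t` by EDF on `m'` machines: the
(at most `m'`) active jobs with smallest deadlines (ties by release date, then index). -/
def edfSched {n : ℕ} (J : Fin n → Job) (m' : ℕ) (t : ℕ) : Finset (Fin n) :=
  select m' (edfLt J) (activeSet J (edfCnt J m' t) t)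

section

open Finset

/-- The run of a work-conserving algorithm on `3 * m` machines for the jobs in `P`, all of length
`p`: `c t i` is the number of slots before `t` in which job `i` is processed, and `proc t` is the
set of jobs processed in slot `t`. The field `release_bound` is the load condition that a
feasible schedule on `m` machines with common deadline `d` imposes. -/
structure IsListRun {ι : Type*} [DecidableEq ι] (P : Finset ι) (r : ι → ℕ) (p m d : ℕ)
    (c : ℕ → ι → ℕ) (proc : ℕ → Finset ι) : Prop where
  zero : ∀ i, c 0 i = 0
  succ : ∀ t i, i ∈ P → c (t + 1) i = c t i + if i ∈ proc t then 1 else 0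
  subset : ∀ t, proc t ⊆ P.filter fun i => r i ≤ t ∧ c t i < p
  all_of_le : ∀ t, #(P.filter fun i => r i ≤ t ∧ c t i < p) ≤ 3 * m →
    proc t = P.filter fun i => r i ≤ t ∧ c t i < p
  full_of_lt : ∀ t, 3 * m < #(P.filter fun i => r i ≤ t ∧ c t i < p) → 3 * m ≤ #(proc t)
  release_bound : ∀ z, p * #(P.filter fun i => z ≤ r i) ≤ m * (d - z)

namespace IsListRun

variable {ι : Type*} [DecidableEq ι] {P : Finset ι} {r : ι → ℕ} {p m d : ℕ}
  {c : ℕ → ι → ℕ} {proc : ℕ → Finset ι}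

/-- The released, unfinished jobs at time `t`. -/
def alive (P : Finset ι) (r : ι → ℕ) (p : ℕ) (c : ℕ → ι → ℕ) (t : ℕ) : Finset ι :=
  P.filter fun i => r i ≤ t ∧ c t i < p

/-- The number of jobs released at time `t` or later. -/
def future (P : Finset ι) (r : ι → ℕ) (t : ℕ) : ℕ := #(P.filter fun i => t ≤ r i)

/-- The total remaining work at time `t`, including that of unreleased jobs. -/
def work (P : Finset ι) (p : ℕ) (c : ℕ → ι → ℕ) (t : ℕ) : ℕ := ∑ i ∈ P, (p - c t i)

/-- The slots in `[a, b)` in which every alive job is processed. -/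
def calm (P : Finset ι) (r : ι → ℕ) (p m : ℕ) (c : ℕ → ι → ℕ) (a b : ℕ) : Finset ℕ :=
  (Ico a b).filter fun t => #(alive P r p c t) ≤ 3 * m

omit [DecidableEq ι] in
theorem mem_alive {t : ℕ} {i : ι} :
    i ∈ alive P r p c t ↔ i ∈ P ∧ r i ≤ t ∧ c t i < p := by
  simp [alive]

theorem proc_subset (h : IsListRun P r p m d c proc) (t : ℕ) :
    proc t ⊆ alive P r p c t := h.subset t

theorem proc_eq (h : IsListRun P r p m d c proc) {t : ℕ}
    (ht : #(alive P r p c t) ≤ 3 * m) : proc t = alive P r p c t := h.all_of_le t ht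

theorem le_card_proc (h : IsListRun P r p m d c proc) {t : ℕ}
    (ht : 3 * m < #(alive P r p c t)) : 3 * m ≤ #(proc t) := h.full_of_lt t ht

theorem future_bound (h : IsListRun P r p m d c proc) (z : ℕ) :
    p * future P r z ≤ m * (d - z) := h.release_bound z

theorem count_le (h : IsListRun P r p m d c proc) {i : ι} (hi : i ∈ P) (t : ℕ) :
    c t i ≤ p := by
  induction t with
  | zero => simp [h.zero]
  | succ t ih =>
    rw [h.succ t i hi]
    split_ifs with hp
    · have := (mem_alive.1 (h.proc_subset t hp)).2.2
      omega
    · omega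

theorem count_mono (h : IsListRun P r p m d c proc) {i : ι} (hi : i ∈ P) :
    Monotone fun t => c t i :=
  monotone_nat_of_le_succ fun t => by
    have := h.succ t i hi
    omega

theorem count_eq_zero (h : IsListRun P r p m d c proc) {i : ι} (hi : i ∈ P) {t : ℕ}
    (ht : t ≤ r i) : c t i = 0 := by
  induction t with
  | zero => exact h.zero i
  | succ t ih =>
    rw [h.succ t i hi, ih (by omega), if_neg]
    intro hp
    have := (mem_alive.1 (h.proc_subset t hp)).2.1
    omega

theorem mem_alive_of_le (h : IsListRun P r p m d c proc) {i : ι} {v t : ℕ}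
    (hi : i ∈ alive P r p c t) (hr : r i ≤ v) (hv : v ≤ t) : i ∈ alive P r p c v := by
  rw [mem_alive] at hi ⊢
  have := h.count_mono hi.1 hv
  simp only at this
  exact ⟨hi.1, hr, by omega⟩

theorem work_succ (h : IsListRun P r p m d c proc) (t : ℕ) :
    work P p c (t + 1) + #(proc t) = work P p c t := by
  have hsub : proc t ⊆ P := (h.subset t).trans (filter_subset _ _)
  have hcard : #(proc t) = ∑ i ∈ P, if i ∈ proc t then 1 else 0 := by
    rw [sum_ite_mem, inter_eq_right.2 hsub, sum_const, smul_eq_mul, mul_one]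
  rw [hcard, work, work, ← sum_add_distrib]
  refine sum_congr rfl fun i hi => ?_
  have h1 := h.succ t i hi
  have h2 := h.count_le hi (t + 1)
  omega

theorem work_add_sum (h : IsListRun P r p m d c proc) {a b : ℕ} (hab : a ≤ b) :
    work P p c b + ∑ t ∈ Ico a b, #(proc t) = work P p c a := by
  induction b, hab using Nat.le_induction with
  | base => simp
  | succ b hab ih =>
    rw [sum_Ico_succ_top hab]
    have := h.work_succ b
    omega

omit [DecidableEq ι] in
theorem calm_succ {a b : ℕ} (hab : a ≤ b) :
    #(calm P r p m c a (b + 1)) =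
      #(calm P r p m c a b) + if #(alive P r p c b) ≤ 3 * m then 1 else 0 := by
  rw [calm, calm, Nat.Ico_succ_right_eq_insert_Ico hab, filter_insert]
  split_ifs
  · rw [card_insert_of_notMem (by simp)]
  · rfl

theorem count_add_calm_le (h : IsListRun P r p m d c proc) {i : ι} (hi : i ∈ P) {a b : ℕ}
    (hr : r i ≤ a) (hab : a ≤ b) (hb : c b i < p) :
    c a i + #(calm P r p m c a b) ≤ c b i := by
  induction b, hab using Nat.le_induction with
  | base => simp [calm]
  | succ b hab ih =>
    have h1 := h.count_mono hi (Nat.le_succ b)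
    simp only [Nat.succ_eq_add_one] at h1
    have h2 := ih (by omega)
    have h3 := h.succ b i hi
    rw [calm_succ hab]
    split_ifs with hc
    · have : i ∈ proc b := by
        rw [h.proc_eq hc, mem_alive]
        exact ⟨hi, by omega, by omega⟩
      rw [if_pos this] at h3
      omega
    · omega

/-- The alive jobs have all been released since some time `b` after which fewer than `p` slots
were calm. -/
theorem exists_earliest_release (h : IsListRun P r p m d c proc) {t : ℕ}
    (ht : (alive P r p c t).Nonempty) :
    ∃ b ≤ t, #(calm P r p m c b t) < p ∧ ∀ i ∈ alive P r p c t, b ≤ r i := by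
  obtain ⟨i, hi, hmin⟩ := exists_min_image _ r ht
  obtain ⟨hiP, hr, hc⟩ := mem_alive.1 hi
  exact ⟨r i, hr, by have := h.count_add_calm_le hiP le_rfl hr hc; omega, hmin⟩

theorem future_add_alive_le {b t : ℕ} (hbt : b ≤ t)
    (hb : ∀ i ∈ alive P r p c t, b ≤ r i) :
    future P r (t + 1) + #(alive P r p c t) ≤ future P r b := by
  rw [future, future, ← card_union_of_disjoint]
  · refine card_le_card fun i hi => ?_
    rcases mem_union.1 hi with hi | hi
    · simp only [mem_filter] at hi ⊢
      exact ⟨hi.1, by omega⟩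
    · exact mem_filter.2 ⟨(mem_alive.1 hi).1, hb i hi⟩
  · rw [disjoint_left]
    intro i hi hi'
    have := (mem_alive.1 hi').2.1
    simp only [mem_filter] at hi
    omega

theorem alive_le_add_future (h : IsListRun P r p m d c proc) {v t : ℕ} (hvt : v ≤ t) :
    #(alive P r p c t) ≤ #(alive P r p c v) + future P r (v + 1) := by
  refine (card_le_card fun i hi => ?_).trans (card_union_le _ _)
  rw [mem_union]
  by_cases hr : r i ≤ v
  · exact Or.inl (h.mem_alive_of_le hi hr hvt)
  · exact Or.inr (mem_filter.2 ⟨(mem_alive.1 hi).1, by omega⟩)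

theorem mul_future_le_work (h : IsListRun P r p m d c proc) (t : ℕ) :
    p * future P r t ≤ work P p c t := by
  rw [work, future, mul_comm, ← smul_eq_mul, ← sum_const]
  refine (sum_le_sum fun i hi => ?_).trans
    (sum_le_sum_of_subset (filter_subset (fun i => t ≤ r i) P))
  rw [mem_filter] at hi
  rw [h.count_eq_zero hi.1 hi.2, Nat.sub_zero]

/-- The slots of `[a, b)` are calm or have at least `3 * m` processed jobs. -/
theorem sum_proc_ge (h : IsListRun P r p m d c proc) (a b : ℕ) :
    3 * m * (b - a) + ∑ v ∈ calm P r p m c a b, #(alive P r p c v) ≤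
      ∑ t ∈ Ico a b, #(proc t) + 3 * m * #(calm P r p m c a b) := by
  have h1 : 3 * m * (b - a) = ∑ _t ∈ Ico a b, 3 * m := by
    rw [sum_const, Nat.card_Ico, smul_eq_mul, mul_comm]
  have h2 : 3 * m * #(calm P r p m c a b) = ∑ _t ∈ calm P r p m c a b, 3 * m := by
    rw [sum_const, smul_eq_mul, mul_comm]
  rw [h1, h2, calm, sum_filter, sum_filter, ← sum_add_distrib, ← sum_add_distrib]
  refine sum_le_sum fun t _ => ?_
  split_ifs with ht
  · rw [h.proc_eq ht]
    omega
  · have := h.le_card_proc (not_le.1 ht)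
    omega

/-- If every one of the last `p` slots was calm, then the remaining work is bounded by
the jobs released since. -/
theorem work_le_of_calm (h : IsListRun P r p m d c proc) {t : ℕ} (ht : t ≤ d)
    (hcalm : ∀ v ∈ Ico (t - p) t, #(alive P r p c v) ≤ 3 * m) (hp : 0 < p) :
    2 * work P p c t ≤ 2 * m * (d - t) + m * (p - 1) := by
  have h1 : work P p c t ≤ ∑ k ∈ range p, future P r (t - k) := by
    simp only [future, card_filter]
    rw [sum_comm, work]
    refine sum_le_sum fun i hi => ?_
    rw [← card_filter]
    have hsub : Ico (t - r i) p ⊆ (range p).filter fun k => t - k ≤ r i := by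
      intro k hk
      simp only [mem_Ico, mem_filter, mem_range] at hk ⊢
      omega
    refine le_trans ?_ (card_le_card hsub)
    rw [Nat.card_Ico]
    by_cases hlt : c t i < p ∧ r i ≤ t
    · have h2 := h.count_add_calm_le hi (a := max (r i) (t - p)) (le_max_left _ _)
        (by omega) hlt.1
      have h3 : calm P r p m c (max (r i) (t - p)) t = Ico (max (r i) (t - p)) t := by
        refine filter_true_of_mem fun v hv => hcalm v ?_
        simp only [mem_Ico] at hv ⊢
        omega
      rw [h3, Nat.card_Ico] at h2
      omega
    · omega
  have h2 : p * ∑ k ∈ range p, future P r (t - k) ≤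
      ∑ k ∈ range p, (m * (d - t) + m * k) := by
    rw [mul_sum]
    refine sum_le_sum fun k _ => (h.future_bound _).trans ?_
    rw [← mul_add]
    exact Nat.mul_le_mul_left _ (by omega)
  rw [sum_add_distrib, sum_const, card_range, smul_eq_mul, ← mul_sum] at h2
  have h3 := sum_range_id_mul_two p
  have h4 : p * (2 * work P p c t) ≤ p * (2 * m * (d - t) + m * (p - 1)) := by
    calc p * (2 * work P p c t) ≤ 2 * (p * ∑ k ∈ range p, future P r (t - k)) := by
          nlinarith [Nat.mul_le_mul_left p h1]
      _ ≤ 2 * (p * (m * (d - t)) + m * ∑ k ∈ range p, k) := Nat.mul_le_mul_left _ h2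
      _ = 2 * (p * (m * (d - t))) + m * ((∑ k ∈ range p, k) * 2) := by ring
      _ = p * (2 * m * (d - t) + m * (p - 1)) := by rw [h3]; ring
  exact Nat.le_of_mul_le_mul_left h4 hp

/-- If slot `w` is not calm but the `k < p` following slots are, and these process fewer
than `m` jobs on average, then the remaining work is bounded by the jobs released since. -/
theorem work_le_of_idle (h : IsListRun P r p m d c proc) {s k : ℕ}
    (hcalm : ∀ v ∈ Ico s (s + k), #(alive P r p c v) ≤ 3 * m)
    (hidle : ∑ v ∈ Ico s (s + k), #(proc v) < m * k) :
    work P p c (s + k) ≤ p * future P r s + m * (p - k) := by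
  set O := (alive P r p c (s + k)).filter fun i => r i < s with hO
  have hOm : #O ≤ m := by
    have h1 : ∑ _v ∈ Ico s (s + k), #O ≤ ∑ v ∈ Ico s (s + k), #(proc v) := by
      refine sum_le_sum fun v hv => card_le_card fun i hi => ?_
      rw [h.proc_eq (hcalm v hv)]
      rw [hO, mem_filter] at hi
      rw [mem_Ico] at hv
      exact h.mem_alive_of_le hi.1 (by omega) (by omega)
    rw [sum_const, Nat.card_Ico, Nat.add_sub_cancel_left, smul_eq_mul] at h1
    by_contra! hlt
    have := Nat.mul_le_mul_left k hlt.le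
    rw [mul_comm m k] at hidle
    omega
  have h1 : work P p c (s + k) ≤
      ∑ i ∈ P, ((if s ≤ r i then p else 0) + if i ∈ O then p - k else 0) := by
    refine sum_le_sum fun i hi => ?_
    by_cases hs : s ≤ r i
    · rw [if_pos hs]
      omega
    · by_cases hc : c (s + k) i < p
      · have hmem : i ∈ O := by
          rw [hO, mem_filter, mem_alive]
          exact ⟨⟨hi, by omega, hc⟩, by omega⟩
        have h2 := h.count_add_calm_le hi (a := s) (by omega) (by omega) hc
        rw [calm, filter_true_of_mem hcalm, Nat.card_Ico] at h2
        rw [if_pos hmem]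
        omega
      · omega
  have hOP : O ⊆ P := (filter_subset _ _).trans (filter_subset _ _)
  rw [sum_add_distrib, ← sum_filter, sum_const, sum_ite_mem, inter_eq_right.2 hOP, sum_const,
    smul_eq_mul, smul_eq_mul] at h1
  refine h1.trans ?_
  rw [future, mul_comm]
  exact Nat.add_le_add_left (Nat.mul_le_mul_right _ hOm) _

theorem work_bound (h : IsListRun P r p m d c proc) (hp : 0 < p) (t : ℕ) (ht : t ≤ d) :
    2 * work P p c t ≤ 2 * m * (d - t) + m * (p - 1) := by
  induction t using Nat.strong_induction_on with
  | _ t ih =>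
  by_cases hcalm : ∀ v ∈ Ico (t - p) t, #(alive P r p c v) ≤ 3 * m
  · exact h.work_le_of_calm ht hcalm hp
  set B := (Ico (t - p) t).filter fun v => 3 * m < #(alive P r p c v) with hB
  have hBne : B.Nonempty := by
    push Not at hcalm
    obtain ⟨v, hv, hv'⟩ := hcalm
    exact ⟨v, mem_filter.2 ⟨hv, hv'⟩⟩
  obtain ⟨w, hwB, hwmax⟩ := exists_max_image B id hBne
  rw [hB, mem_filter, mem_Ico] at hwB
  obtain ⟨⟨hw1, hw2⟩, hw⟩ := hwB
  obtain ⟨k, rfl⟩ : ∃ k, t = w + 1 + k := ⟨t - (w + 1), by omega⟩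
  have hkp : k < p := by omega
  have hcalm' : ∀ v ∈ Ico (w + 1) (w + 1 + k), #(alive P r p c v) ≤ 3 * m := by
    intro v hv
    by_contra! hlt
    rw [mem_Ico] at hv
    have := hwmax v (mem_filter.2 ⟨mem_Ico.2 ⟨by omega, by omega⟩, hlt⟩)
    simp only [id] at this
    omega
  obtain ⟨e, rfl⟩ : ∃ e, d = w + 1 + k + e := ⟨d - (w + 1 + k), by omega⟩
  obtain ⟨q, rfl⟩ : ∃ q, p = q + 1 := ⟨p - 1, by omega⟩
  have hproc := h.le_card_proc hw
  have hwork := h.work_succ w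
  by_cases hidle : ∑ v ∈ Ico (w + 1) (w + 1 + k), #(proc v) < m * k
  · have h1 := h.work_le_of_idle hcalm' hidle
    obtain ⟨b, hbw, hb, hbr⟩ := h.exists_earliest_release (card_pos.1 (Nat.zero_lt_of_lt hw))
    obtain ⟨x, rfl⟩ : ∃ x, w = b + x := ⟨w - b, by omega⟩
    have h2 := Nat.mul_le_mul_left (q + 1) (future_add_alive_le hbw hbr)
    have h3 := h.future_bound b
    have h4 := ih b (by omega) (by omega)
    have h5 := h.work_add_sum hbw
    have h6 := h.sum_proc_ge b (b + x)
    have h7 := h.mul_future_le_work (b + x + 1)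
    have e1 : b + x + 1 + k + e - b = x + 1 + k + e := by omega
    have e2 : b + x + 1 + k + e - (b + x + 1 + k) = e := by omega
    have e3 : b + x - b = x := by omega
    obtain ⟨y, hy⟩ : ∃ y, q = k + y := ⟨q - k, by omega⟩
    have e4 : q + 1 - k = y + 1 := by omega
    rw [e1] at h3 h4
    rw [e3] at h6
    rw [e4] at h1
    rw [e2]
    simp only [Nat.add_sub_cancel] at h4 ⊢
    set N := future P r (b + x + 1)
    set u := #(calm P r (q + 1) m c b (b + x))
    have hu : u ≤ q := by omega
    have h8 : (q + 1) * (3 * m + 1) ≤ (q + 1) * #(alive P r (q + 1) c (b + x)) :=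
      Nat.mul_le_mul_left _ hw
    have hux : u ≤ x := by
      have : u ≤ #(Ico b (b + x)) := card_filter_le _ _
      rwa [Nat.card_Ico, e3] at this
    obtain ⟨f, hf⟩ : ∃ f, x = u + f := ⟨x - u, by omega⟩
    by_contra! hcon
    have hmq : m * q = m * k + m * y := by rw [hy, mul_add]
    have h9 : (q + 1) * N + (q + 1) * (3 * m + 1) ≤ m * (x + 1 + k + e) := by
      rw [mul_add] at h2
      omega
    have h10 : (q + 1) * N + 3 * m * (f + 1) ≤ work P (q + 1) c b := by
      have : 3 * m * x = 3 * m * u + 3 * m * f := by rw [hf]; ring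
      have : 3 * m * (f + 1) = 3 * m * f + 3 * m := by ring
      omega
    have hm : 0 < m := by
      rcases Nat.eq_zero_or_pos m with rfl | hm
      · simp at hidle
      · exact hm
    have h11 : 3 * (f + 1) < x + q + 2 := by
      refine Nat.lt_of_mul_lt_mul_left (a := 2 * m) ?_
      linarith
    have h12 : f < q := by omega
    have h13 : m * x ≤ m * (2 * q) := Nat.mul_le_mul_left _ (by omega)
    linarith [Nat.zero_le (m * q)]
  · rw [not_lt] at hidle
    have h1 := ih w (by omega) (by omega)
    have h2 := h.work_add_sum (show w + 1 ≤ w + 1 + k by omega)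
    have e1 : w + 1 + k + e - w = 1 + k + e := by omega
    have e2 : w + 1 + k + e - (w + 1 + k) = e := by omega
    rw [e1] at h1
    rw [e2]
    simp only [Nat.add_sub_cancel] at h1 ⊢
    linarith

theorem card_mul_le_sum_of_le (S : Finset ℕ) (b : ℕ) (hS : ∀ v ∈ S, b ≤ v) :
    2 * #S * b + #S * (#S - 1) ≤ 2 * ∑ v ∈ S, v := by
  induction S using Finset.induction_on_max with
  | empty => simp
  | insert a S ha ih =>
    have haS : a ∉ S := fun hmem => lt_irrefl _ (ha a hmem)
    have h1 := ih fun v hv => hS v (mem_insert_of_mem hv)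
    have h2 : #S ≤ a - b := by
      rw [← Nat.card_Ico]
      exact card_le_card fun v hv => mem_Ico.2 ⟨hS v (mem_insert_of_mem hv), ha v hv⟩
    have h3 := hS a (mem_insert_self a S)
    rw [card_insert_of_notMem haS, sum_insert haS, Nat.add_sub_cancel]
    have h4 : #S * (#S - 1) + 2 * #S = (#S + 1) * #S := by
      cases #S with
      | zero => rfl
      | succ k => simp only [Nat.add_sub_cancel]; ring
    have h5 : #S + b ≤ a := by omega
    nlinarith

theorem calm_arith {e q x y : ℕ} (hqe : q ≤ e) (hey : 3 * (e + 1) ≤ y + 1) (hyx : y ≤ x + e) :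
    (e + 1) * (2 * (y + 1) + e) + 2 * q * y + q < 6 * (e + 1) * (x + 1) + q * q := by
  obtain ⟨g, rfl⟩ : ∃ g, e = q + g := ⟨e - q, by omega⟩
  obtain ⟨z, rfl⟩ : ∃ z, y = 3 * (q + g) + 2 + z := ⟨y - (3 * (q + g) + 2), by omega⟩
  obtain ⟨u, rfl⟩ : ∃ u, x = 2 * (q + g) + 2 + z + u := ⟨x - (2 * (q + g) + 2 + z), by omega⟩
  linarith [Nat.zero_le (q * g), Nat.zero_le (g * g), Nat.zero_le (q * z), Nat.zero_le (g * z),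
    Nat.zero_le (q * u), Nat.zero_le (g * u)]

/-- In the last `p` slots before the common deadline no alive job is delayed. -/
theorem card_alive_le (h : IsListRun P r p m d c proc) (hp : 0 < p) {t : ℕ} (htd : t < d)
    (hdt : d ≤ t + p) : #(alive P r p c t) ≤ 3 * m := by
  by_contra! hfull
  obtain ⟨b, hbt, hb, hbr⟩ := h.exists_earliest_release (card_pos.1 (Nat.zero_lt_of_lt hfull))
  have h1 := (Nat.mul_le_mul_left p (future_add_alive_le hbt hbr)).trans (h.future_bound b)
  have h2 := h.work_bound hp b (by omega)
  have h3 := h.work_add_sum hbt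
  have h4 := h.sum_proc_ge b t
  have h5 := h.work_succ t
  have h6 := h.le_card_proc hfull
  have h7 : #(calm P r p m c b t) * (3 * m + 1) ≤
      ∑ v ∈ calm P r p m c b t, (#(alive P r p c v) + future P r (v + 1)) := by
    rw [← smul_eq_mul, ← sum_const]
    refine sum_le_sum fun v hv => hfull.trans_le (h.alive_le_add_future ?_)
    have := mem_Ico.1 (mem_of_mem_filter v hv)
    omega
  have h8 : p * ∑ v ∈ calm P r p m c b t, future P r (v + 1) +
      m * ∑ v ∈ calm P r p m c b t, v ≤ #(calm P r p m c b t) * (m * (d - 1)) := by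
    rw [mul_sum, mul_sum, ← sum_add_distrib, ← smul_eq_mul, ← sum_const]
    refine sum_le_sum fun v hv => (Nat.add_le_add_right (h.future_bound _) _).trans ?_
    have := mem_Ico.1 (mem_of_mem_filter v hv)
    rw [← mul_add]
    exact Nat.mul_le_mul_left _ (by omega)
  have h9 := card_mul_le_sum_of_le (calm P r p m c b t) b fun v hv =>
    (mem_Ico.1 (mem_of_mem_filter v hv)).1
  rw [sum_add_distrib] at h7
  have h10 : p * (3 * m + 1) ≤ m * (d - b) :=
    (Nat.mul_le_mul_left p (show 3 * m + 1 ≤ _ by omega)).trans h1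
  set q := #(calm P r p m c b t)
  set A := ∑ v ∈ calm P r p m c b t, #(alive P r p c v)
  set F := ∑ v ∈ calm P r p m c b t, future P r (v + 1)
  set V := ∑ v ∈ calm P r p m c b t, v
  have hm : 0 < m := by
    rcases Nat.eq_zero_or_pos m with rfl | hm
    · simp at h10; omega
    · exact hm
  clear_value q A F V
  obtain ⟨e, rfl⟩ : ∃ e, p = e + 1 := ⟨p - 1, by omega⟩
  obtain ⟨x, rfl⟩ : ∃ x, t = b + x := ⟨t - b, by omega⟩
  obtain ⟨y, rfl⟩ : ∃ y, d = b + (y + 1) := ⟨d - b - 1, by omega⟩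
  have hq : q * q ≤ q * (q - 1) + q := by
    cases q with
    | zero => rfl
    | succ k => simp only [Nat.add_sub_cancel]; linarith
  have hy : b + (y + 1) - 1 = b + y := rfl
  rw [hy] at h8
  simp only [Nat.add_sub_cancel_left, Nat.add_sub_cancel] at h2 h4 h8 h10
  have h11 : 6 * m * (x + 1) + 2 * A ≤ 2 * m * (y + 1) + m * e + 6 * m * q := by
    linarith
  have h12 : m * (2 * q * b + q * q) ≤ m * (2 * V + q) := Nat.mul_le_mul_left _ (by omega)
  have h13 := Nat.mul_le_mul_left (e + 1) h11
  have h14 := Nat.mul_le_mul_left (2 * (e + 1)) h7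
  have h15 : m * (6 * (e + 1) * (x + 1) + q * q) ≤
      m * ((e + 1) * (2 * (y + 1) + e) + 2 * q * y + q) := by
    linarith [Nat.zero_le ((e + 1) * q)]
  have h16 := Nat.le_of_mul_le_mul_left h15 hm
  have h17 : 3 * (e + 1) ≤ y + 1 := by
    refine Nat.le_of_mul_le_mul_left (?_ : m * _ ≤ m * _) hm
    linarith
  have h18 : y ≤ x + e := by omega
  exact absurd h16 (not_le.2 (calm_arith (by omega) h17 h18))

end IsListRun

end

section

open Finset

theorem card_filter_rank_lt {α : Type*} [DecidableEq α] (lt : α → α → Prop) [DecidableRel lt]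
    (hirr : ∀ a, ¬ lt a a) (htrans : ∀ a b c, lt a b → lt b c → lt a c)
    (htri : ∀ a b, lt a b ∨ a = b ∨ lt b a) (B : Finset α) (k : ℕ) (hk : k ≤ #B) :
    #(B.filter fun x => #(B.filter fun y => lt y x) < k) = k := by
  set rank : α → ℕ := fun x => #(B.filter fun y => lt y x) with hrank
  have hmono : ∀ a ∈ B, ∀ b, lt a b → rank a < rank b := by
    intro a ha b hab
    refine card_lt_card ⟨fun y hy => ?_, fun hsub => ?_⟩
    · rw [mem_filter] at hy ⊢
      exact ⟨hy.1, htrans _ _ _ hy.2 hab⟩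
    · exact hirr a (mem_filter.1 (hsub (mem_filter.2 ⟨ha, hab⟩))).2
  have hinj : Set.InjOn rank B := by
    intro a ha b hb hab
    rcases htri a b with hlt | heq | hlt
    · exact absurd hab (hmono a ha b hlt).ne
    · exact heq
    · exact absurd hab (hmono b hb a hlt).ne'
  have himage : B.image rank = range #B := by
    refine eq_of_subset_of_card_le (fun x hx => ?_) ?_
    · obtain ⟨a, ha, rfl⟩ := mem_image.1 hx
      rw [mem_range]
      refine card_lt_card ⟨filter_subset _ _, fun hsub => ?_⟩
      exact hirr a (mem_filter.1 (hsub ha)).2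
    · rw [card_image_of_injOn hinj, card_range]
  have himage' : (B.filter fun x => rank x < k).image rank = range k := by
    ext x
    simp only [mem_image, mem_filter, mem_range]
    constructor
    · rintro ⟨a, ⟨_, ha⟩, rfl⟩
      exact ha
    · intro hx
      have hmem : x ∈ B.image rank := by
        rw [himage, mem_range]
        omega
      obtain ⟨a, ha, rfl⟩ := mem_image.1 hmem
      exact ⟨a, ⟨ha, hx⟩, rfl⟩
  rw [← card_image_of_injOn (hinj.mono (filter_subset _ _)), himage', card_range]

variable {n : ℕ} {J : Fin n → Job}

theorem edfLt_irrefl (a : Fin n) : ¬ edfLt J a a := by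
  simp [edfLt]

theorem edfLt_trans (a b c : Fin n) (hab : edfLt J a b) (hbc : edfLt J b c) :
    edfLt J a c := by
  unfold edfLt at *
  omega

theorem edfLt_trichotomy (a b : Fin n) : edfLt J a b ∨ a = b ∨ edfLt J b a := by
  unfold edfLt
  omega

/-- The jobs of EDF priority at least that of `j`. -/
def edfPrefix (J : Fin n → Job) (j : Fin n) : Finset (Fin n) :=
  univ.filter fun k => edfLt J k j ∨ k = j

theorem mem_edfPrefix {j k : Fin n} : k ∈ edfPrefix J j ↔ edfLt J k j ∨ k = j := by
  simp [edfPrefix]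

theorem mem_edfPrefix_of_edfLt {j k l : Fin n} (hk : k ∈ edfPrefix J j) (hl : edfLt J l k) :
    l ∈ edfPrefix J j := by
  rw [mem_edfPrefix] at hk ⊢
  rcases hk with hk | rfl
  · exact Or.inl (edfLt_trans _ _ _ hl hk)
  · exact Or.inl hl

theorem deadline_le_of_mem_edfPrefix {j k : Fin n} (hk : k ∈ edfPrefix J j) :
    (J k).d ≤ (J j).d := by
  rcases mem_edfPrefix.1 hk with hk | rfl
  · unfold edfLt at hk
    omega
  · exact le_rfl

/-- Jobs outside an EDF prefix do not influence which jobs of the prefix are selected. -/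
theorem filter_select_edfLt (j : Fin n) (k : ℕ) (A : Finset (Fin n)) :
    (select k (edfLt J) A).filter (· ∈ edfPrefix J j) =
      (A.filter (· ∈ edfPrefix J j)).filter fun x =>
        #((A.filter (· ∈ edfPrefix J j)).filter fun y => edfLt J y x) < k := by
  ext x
  simp only [select, mem_filter]
  constructor
  · rintro ⟨⟨hxA, hx⟩, hxP⟩
    refine ⟨⟨hxA, hxP⟩, lt_of_le_of_lt (card_le_card ?_) hx⟩
    exact filter_subset_filter _ (filter_subset _ _)
  · rintro ⟨⟨hxA, hxP⟩, hx⟩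
    refine ⟨⟨hxA, lt_of_le_of_lt (card_le_card fun y hy => ?_) hx⟩, hxP⟩
    rw [mem_filter] at hy
    exact mem_filter.2 ⟨mem_filter.2 ⟨hy.1, mem_edfPrefix_of_edfLt hxP hy.2⟩, hy.2⟩

/-- The jobs released at `z` or later with deadline at most `d` have to be processed
in `[z, d)`. -/
theorem FeasiblePre.load_le {m : ℕ} (hm : FeasiblePre J m) {p : ℕ} (hp : ∀ j, (J j).p = p)
    (Q : Finset (Fin n)) (z d : ℕ) (hr : ∀ i ∈ Q, z ≤ (J i).r) (hd : ∀ i ∈ Q, (J i).d ≤ d) :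
    p * #Q ≤ m * (d - z) := by
  obtain ⟨S, hcard, hwin, htot⟩ := hm
  calc p * #Q = ∑ i ∈ Q, #((range (J i).d).filter fun t => i ∈ S t) := by
        rw [sum_congr rfl fun i _ => (htot i).trans (hp i), sum_const, smul_eq_mul, mul_comm]
    _ ≤ ∑ i ∈ Q, #((Ico z d).filter fun t => i ∈ S t) := by
        refine sum_le_sum fun i hi => card_le_card fun t ht => ?_
        rw [mem_filter] at ht ⊢
        have h1 := hwin t i ht.2
        have h2 := hr i hi
        have h3 := hd i hi
        exact ⟨mem_Ico.2 ⟨by omega, by omega⟩, ht.2⟩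
    _ = ∑ t ∈ Ico z d, #(Q.filter fun i => i ∈ S t) := by
        simp only [card_filter]
        exact sum_comm
    _ ≤ ∑ _t ∈ Ico z d, m := by
        refine sum_le_sum fun t _ => (card_le_card fun i hi => ?_).trans (hcard t)
        exact (mem_filter.1 hi).2
    _ = m * (d - z) := by rw [sum_const, Nat.card_Ico, smul_eq_mul, mul_comm]

theorem filter_activeSet_edfPrefix {p : ℕ} (hp : ∀ j, (J j).p = p) (c : Fin n → ℕ) (t : ℕ)
    (j : Fin n) : (activeSet J c t).filter (· ∈ edfPrefix J j) =
      (edfPrefix J j).filter fun i => (J i).r ≤ t ∧ c i < p := by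
  ext i
  simp only [activeSet, mem_filter, mem_univ, true_and, hp]
  tauto

theorem isListRun_edf {p m : ℕ} (hp : ∀ j, (J j).p = p) (hm : FeasiblePre J m) (j : Fin n) :
    IsListRun (edfPrefix J j) (fun i => (J i).r) p m (J j).d (edfCnt J (3 * m))
      (fun t => (edfSched J (3 * m) t).filter (· ∈ edfPrefix J j)) where
  zero _ := rfl
  succ t i hi := by simp [edfCnt, edfSched, hi]
  subset t := by
    rw [edfSched, filter_select_edfLt, filter_activeSet_edfPrefix hp]
    exact filter_subset _ _
  all_of_le t ht := by
    rw [edfSched, filter_select_edfLt, filter_activeSet_edfPrefix hp]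
    refine filter_true_of_mem fun x hx => lt_of_lt_of_le (card_lt_card ?_) ht
    exact ⟨filter_subset _ _, fun hsub => edfLt_irrefl x (mem_filter.1 (hsub hx)).2⟩
  full_of_lt t ht := by
    rw [edfSched, filter_select_edfLt, filter_activeSet_edfPrefix hp,
      card_filter_rank_lt (edfLt J) edfLt_irrefl edfLt_trans edfLt_trichotomy _ _ ht.le]
  release_bound z := hm.load_le hp _ z _ (fun i hi => (mem_filter.1 hi).2) fun i hi =>
    deadline_le_of_mem_edfPrefix (mem_filter.1 hi).1

theorem card_filter_edfSched (k t : ℕ) (j : Fin n) :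
    #((range t).filter fun s => j ∈ edfSched J k s) = edfCnt J k t j := by
  induction t with
  | zero => rfl
  | succ t ih =>
    have hs : edfCnt J k (t + 1) j = edfCnt J k t j + if j ∈ edfSched J k t then 1 else 0 := rfl
    rw [range_add_one, filter_insert, hs, ← ih]
    split_ifs
    · rw [card_insert_of_notMem (by simp)]
    · rfl

end

/-- If all jobs have the same processing time `p` and `J` admits a
feasible preemptive schedule on `m` machines, then the EDF schedule of `J` on `3m`
machines completes every job by its deadline. -/
theorem edf_equal_processing_three_competitive {n : ℕ} (J : Fin n → Job)
    (hval : ∀ j, (J j).valid)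
    (p : ℕ) (hp : ∀ j, (J j).p = p)
    (m : ℕ) (hm : FeasiblePre J m) :
    ∀ j, ((Finset.Ico (J j).r (J j).d).filter (fun t => j ∈ edfSched J (3 * m) t)).card
      = (J j).p := by
  intro j
  have hrun := isListRun_edf hp hm j
  have hj : j ∈ edfPrefix J j := Finset.mem_filter.2 ⟨Finset.mem_univ j, Or.inr rfl⟩
  obtain ⟨hp1, hwin⟩ := hval j
  rw [hp] at hp1 hwin ⊢
  have hcnt : ((Finset.Ico (J j).r (J j).d).filter
      (fun t => j ∈ edfSched J (3 * m) t)).card = edfCnt J (3 * m) (J j).d j := by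
    rw [← card_filter_edfSched]
    congr 1
    ext t
    simp only [Finset.mem_filter, Finset.mem_Ico, Finset.mem_range]
    refine ⟨fun h => ⟨h.1.2, h.2⟩, fun h => ⟨⟨?_, h.1⟩, h.2⟩⟩
    have := hrun.subset t (Finset.mem_filter.2 ⟨h.2, hj⟩)
    exact (Finset.mem_filter.1 this).2.1
  rw [hcnt]
  refine le_antisymm (hrun.count_le hj _) ?_
  by_contra! hlt
  have hcalm : IsListRun.calm (edfPrefix J j) (fun i => (J i).r) p m (edfCnt J (3 * m))
      ((J j).d - p) (J j).d = Finset.Ico ((J j).d - p) (J j).d := by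
    refine Finset.filter_true_of_mem fun t ht => ?_
    rw [Finset.mem_Ico] at ht
    exact hrun.card_alive_le hp1 ht.2 (by omega)
  have h := hrun.count_add_calm_le hj (a := (J j).d - p) (b := (J j).d) (by omega) (by omega) hlt
  rw [hcalm, Nat.card_Ico] at h
  omega
end

section
/- Let J be an instance in which all jobs have the same deadline, i.e., d_j = d for all j ∈ J, and suppose J admits a feasible preemptive schedule on m machines. Then the LLF schedule of J on m machines completes every job by its deadline. -/
/-- The current laxity `ℓ_j(t) = d_j - t - (p_j - c j)` of job `j` at time `t`, given
that it has been processed for `c j` slots so far. -/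
def curLax {n : ℕ} (J : Fin n → Job) (c : Fin n → ℕ) (t : ℕ) (j : Fin n) : ℤ :=
  ((J j).d : ℤ) - (t : ℤ) - (((J j).p - c j : ℕ) : ℤ)

/-- LLF priority at time `t`: smaller current laxity first, ties broken by earlier
release date, then by lower index. -/
def llfLt {n : ℕ} (J : Fin n → Job) (c : Fin n → ℕ) (t : ℕ) (a b : Fin n) : Prop :=
  curLax J c t a < curLax J c t b ∨
    (curLax J c t a = curLax J c t b ∧
      ((J a).r < (J b).r ∨ ((J a).r = (J b).r ∧ a < b)))

instance {n : ℕ} (J : Fin n → Job) (c : Fin n → ℕ) (t : ℕ) :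
    DecidableRel (llfLt J c t) := fun a b => by
  unfold llfLt; infer_instance

/-- The set of jobs eligible for LLF at time `t`: released, unfinished, and with
nonnegative current laxity. -/
def llfActive {n : ℕ} (J : Fin n → Job) (c : Fin n → ℕ) (t : ℕ) : Finset (Fin n) :=
  Finset.univ.filter (fun j => (J j).r ≤ t ∧ c j < (J j).p ∧ 0 ≤ curLax J c t j)

/-- `llfCnt J m' t j` is the number of slots before time `t` in which the LLF schedule
on `m'` machines processes job `j`. -/
def llfCnt {n : ℕ} (J : Fin n → Job) (m' : ℕ) : ℕ → Fin n → ℕ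
  | 0 => fun _ => 0
  | t + 1 => fun j =>
      llfCnt J m' t j +
        (if j ∈ select m' (llfLt J (llfCnt J m' t) t) (llfActive J (llfCnt J m' t) t)
          then 1 else 0)

/-- The set of jobs processed in slot `t` by LLF on `m'` machines: the (at most `m'`)
active jobs with the smallest nonnegative current laxity (ties by release date, then
index). -/
def llfSched {n : ℕ} (J : Fin n → Job) (m' : ℕ) (t : ℕ) : Finset (Fin n) :=
  select m' (llfLt J (llfCnt J m' t) t) (llfActive J (llfCnt J m' t) t)

/-- `S` is a feasible preemptive schedule of `J` on `m` machines. -/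
def IsFeasibleSchedule {n : ℕ} (J : Fin n → Job) (m : ℕ) (S : ℕ → Finset (Fin n)) : Prop :=
  (∀ t, (S t).card ≤ m) ∧
    (∀ t j, j ∈ S t → (J j).r ≤ t ∧ t < (J j).d) ∧
    (∀ j, ((Finset.range (J j).d).filter (fun t => j ∈ S t)).card = (J j).p)

/-- The schedule obtained from `S` by interchanging the slots `t` and `t'` for the jobs in `U`. -/
def interchange {n : ℕ} (S : ℕ → Finset (Fin n)) (U : Finset (Fin n)) (t t' : ℕ) :
    ℕ → Finset (Fin n) :=
  fun s => Finset.univ.filter fun i => i ∈ S (if i ∈ U then Equiv.swap t t' s else s)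

theorem mem_interchange {n : ℕ} {S : ℕ → Finset (Fin n)} {U : Finset (Fin n)} {t t' s : ℕ}
    {i : Fin n} :
    i ∈ interchange S U t t' s ↔ i ∈ S (if i ∈ U then Equiv.swap t t' s else s) := by
  simp [interchange]

theorem interchange_of_ne {n : ℕ} {S : ℕ → Finset (Fin n)} {U : Finset (Fin n)} {t t' s : ℕ}
    (h : s ≠ t) (h' : s ≠ t') : interchange S U t t' s = S s := by
  ext i
  rw [mem_interchange, Equiv.swap_apply_of_ne_of_ne h h', ite_self]

theorem IsFeasibleSchedule.interchange {n : ℕ} {J : Fin n → Job} {m d : ℕ}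
    {S : ℕ → Finset (Fin n)} {U : Finset (Fin n)} {t t' : ℕ} (hS : IsFeasibleSchedule J m S)
    (hd : ∀ j, (J j).d = d) (htt' : t < t') (ht' : t' < d) (hU : ∀ i ∈ U, (J i).r ≤ t)
    (hc : (interchange S U t t' t).card ≤ m) (hc' : (interchange S U t t' t').card ≤ m) :
    IsFeasibleSchedule J m (interchange S U t t') := by
  obtain ⟨h1, h2, h3⟩ := hS
  refine ⟨fun s => ?_, fun s i hi => ?_, fun i => ?_⟩
  · by_cases hs : s = t
    · exact hs ▸ hc
    by_cases hs' : s = t'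
    · exact hs' ▸ hc'
    rw [interchange_of_ne hs hs']
    exact h1 s
  · by_cases hs : s = t ∨ s = t'
    · rw [mem_interchange] at hi
      have := hd i
      split_ifs at hi with hiU
      · have := hU i hiU
        omega
      · exact h2 s i hi
    · push Not at hs
      rw [interchange_of_ne hs.1 hs.2] at hi
      exact h2 s i hi
  · rw [← h3 i]
    simp only [mem_interchange]
    by_cases hiU : i ∈ U
    · simp only [hiU, if_true]
      have hlt : ∀ s < d, Equiv.swap t t' s < d := fun s hs => by
        rw [Equiv.swap_apply_def]
        split_ifs <;> omega
      refine Finset.card_nbij' (Equiv.swap t t') (Equiv.swap t t') ?_ ?_ ?_ ?_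
      · intro s hs
        simp only [hd, Finset.coe_filter, Finset.mem_range, Set.mem_ofPred_eq] at hs ⊢
        exact ⟨hlt s hs.1, hs.2⟩
      · intro s hs
        simp only [hd, Finset.coe_filter, Finset.mem_range, Set.mem_ofPred_eq] at hs ⊢
        exact ⟨hlt s hs.1, by simpa using hs.2⟩
      · intro s _
        simp
      · intro s _
        simp
    · simp [hiU]

section select

variable {n : ℕ} {α : Type*} [LinearOrder α] {m : ℕ} {lt : Fin n → Fin n → Prop}
  [DecidableRel lt] {f : Fin n → α} {A : Finset (Fin n)}

theorem card_select_le (hlt : ∀ a b, lt a b ↔ f a < f b) (hf : Function.Injective f) :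
    (select m lt A).card ≤ m := by
  rcases (select m lt A).eq_empty_or_nonempty with h | h
  · simp [h]
  obtain ⟨x, hx, hmax⟩ := Finset.exists_max_image _ f h
  have hsub : (select m lt A).erase x ⊆ A.filter fun k => lt k x := by
    intro y hy
    rw [Finset.mem_erase] at hy
    rw [Finset.mem_filter, hlt]
    exact ⟨(Finset.mem_filter.1 hy.2).1,
      lt_of_le_of_ne (hmax y hy.2) fun h => hy.1 (hf h)⟩
  have h1 := Finset.card_le_card hsub
  have h2 := (Finset.mem_filter.1 hx).2
  rw [Finset.card_erase_of_mem hx] at h1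
  omega

theorem le_card_select (hlt : ∀ a b, lt a b ↔ f a < f b) {k : Fin n} (hk : k ∈ A)
    (hk' : k ∉ select m lt A) : m ≤ (select m lt A).card := by
  obtain ⟨x, hx, hmin⟩ := Finset.exists_min_image (A \ select m lt A) f
    ⟨k, Finset.mem_sdiff.2 ⟨hk, hk'⟩⟩
  rw [Finset.mem_sdiff] at hx
  have hsub : (A.filter fun k => lt k x) ⊆ select m lt A := by
    intro y hy
    rw [Finset.mem_filter, hlt] at hy
    by_contra hn
    exact (hmin y (Finset.mem_sdiff.2 ⟨hy.1, hn⟩)).not_gt hy.2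
  refine le_trans ?_ (Finset.card_le_card hsub)
  by_contra hn
  exact hx.2 (Finset.mem_filter.2 ⟨hx.1, not_le.1 hn⟩)

theorem le_of_mem_select (hlt : ∀ a b, lt a b ↔ f a < f b) {j k : Fin n}
    (hj : j ∈ select m lt A) (hk : k ∈ A) (hk' : k ∉ select m lt A) : f j ≤ f k := by
  by_contra! hkj
  refine hk' (Finset.mem_filter.2 ⟨hk, lt_of_le_of_lt (Finset.card_le_card ?_)
    (Finset.mem_filter.1 hj).2⟩)
  intro x hx
  rw [Finset.mem_filter, hlt] at hx ⊢
  exact ⟨hx.1, hx.2.trans hkj⟩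

end select

/-- The key by which LLF orders the jobs lexicographically. -/
def llfKey {n : ℕ} (J : Fin n → Job) (c : Fin n → ℕ) (t : ℕ) (j : Fin n) : ℤ ×ₗ ℕ ×ₗ Fin n :=
  toLex (curLax J c t j, toLex ((J j).r, j))

theorem llfLt_iff {n : ℕ} (J : Fin n → Job) (c : Fin n → ℕ) (t : ℕ) (a b : Fin n) :
    llfLt J c t a b ↔ llfKey J c t a < llfKey J c t b := by
  simp [llfLt, llfKey, Prod.Lex.toLex_lt_toLex]

theorem llfKey_injective {n : ℕ} (J : Fin n → Job) (c : Fin n → ℕ) (t : ℕ) :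
    Function.Injective (llfKey J c t) := by
  intro a b h
  simp only [llfKey, EmbeddingLike.apply_eq_iff_eq, Prod.mk.injEq] at h
  exact h.2.2

theorem curLax_le_of_llfKey_le {n : ℕ} {J : Fin n → Job} {c : Fin n → ℕ} {t : ℕ} {a b : Fin n}
    (h : llfKey J c t a ≤ llfKey J c t b) : curLax J c t a ≤ curLax J c t b := by
  rw [llfKey, llfKey, Prod.Lex.toLex_le_toLex] at h
  rcases h with h | h
  · exact h.le
  · exact h.1.le

theorem llfCnt_eq_card {n : ℕ} {J : Fin n → Job} {m t : ℕ} {S : ℕ → Finset (Fin n)}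
    (h : ∀ s < t, S s = llfSched J m s) (j : Fin n) :
    llfCnt J m t j = ((Finset.range t).filter fun s => j ∈ S s).card := by
  induction t with
  | zero => simp [llfCnt]
  | succ t ih =>
    rw [llfCnt]
    beta_reduce
    rw [ih fun s hs => h s (hs.trans t.lt_succ_self), Finset.range_add_one,
      Finset.filter_insert, h t t.lt_succ_self, llfSched]
    split_ifs <;> simp

theorem IsFeasibleSchedule.llfCnt_add_card {n : ℕ} {J : Fin n → Job} {m d t : ℕ}
    {S : ℕ → Finset (Fin n)} (hS : IsFeasibleSchedule J m S) (hd : ∀ j, (J j).d = d)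
    (ht : t < d) (h : ∀ s < t, S s = llfSched J m s) (j : Fin n) :
    llfCnt J m t j + ((Finset.Ico t d).filter fun s => j ∈ S s).card = (J j).p := by
  rw [llfCnt_eq_card h, ← hS.2.2 j, hd, Finset.range_eq_Ico, Finset.range_eq_Ico,
    ← Finset.Ico_union_Ico_eq_Ico (Nat.zero_le t) ht.le, Finset.filter_union,
    Finset.card_union_of_disjoint]
  exact Finset.disjoint_filter_filter (Finset.Ico_disjoint_Ico_consecutive 0 t d)

theorem IsFeasibleSchedule.subset_llfActive {n : ℕ} {J : Fin n → Job} {m d t : ℕ}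
    {S : ℕ → Finset (Fin n)} (hS : IsFeasibleSchedule J m S) (hd : ∀ j, (J j).d = d)
    (ht : t < d) (h : ∀ s < t, S s = llfSched J m s) :
    S t ⊆ llfActive J (llfCnt J m t) t := by
  intro i hi
  have hcard := hS.llfCnt_add_card hd ht h i
  have hpos : 0 < ((Finset.Ico t d).filter fun s => i ∈ S s).card :=
    Finset.card_pos.2 ⟨t, by simp [ht, hi]⟩
  have hle : ((Finset.Ico t d).filter fun s => i ∈ S s).card ≤ d - t :=
    (Finset.card_filter_le _ _).trans (by simp)
  simp only [llfActive, Finset.mem_filter, Finset.mem_univ, true_and, curLax, hd]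
  exact ⟨(hS.2.1 t i hi).1, by omega, by omega⟩

/-- A feasible schedule following LLF before slot `t` but missing an LLF job `j` in slot `t` can be
modified in the slots from `t` on so that it runs `j` in slot `t` and only loses jobs there that LLF
does not run. -/
theorem IsFeasibleSchedule.exists_exchange {n : ℕ} {J : Fin n → Job} {m d t : ℕ}
    {S : ℕ → Finset (Fin n)} (hS : IsFeasibleSchedule J m S) (hd : ∀ j, (J j).d = d)
    (ht : t < d) (h : ∀ s < t, S s = llfSched J m s) {j : Fin n} (hj : j ∈ llfSched J m t)
    (hjS : j ∉ S t) :
    ∃ S', IsFeasibleSchedule J m S' ∧ (∀ s < t, S' s = llfSched J m s) ∧ j ∈ S' t ∧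
      ∀ i ∈ llfSched J m t, i ∈ S t → i ∈ S' t := by
  have hjA := (Finset.mem_filter.1 hj).1
  simp only [llfActive, Finset.mem_filter, Finset.mem_univ, true_and] at hjA
  have hjc := hS.llfCnt_add_card hd ht h j
  have hagree : ∀ U t', t < t' → ∀ s < t, _root_.interchange S U t t' s = llfSched J m s :=
    fun U t' htt' s hs => by rw [interchange_of_ne (by omega) (by omega), h s hs]
  by_cases hidle : (S t).card < m
  · obtain ⟨t', ht'⟩ := Finset.card_pos.1
      (show 0 < ((Finset.Ico t d).filter fun s => j ∈ S s).card by omega)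
    simp only [Finset.mem_filter, Finset.mem_Ico] at ht'
    have htt' : t < t' := lt_of_le_of_ne ht'.1.1 fun he => hjS (he ▸ ht'.2)
    refine ⟨_root_.interchange S {j} t t',
      hS.interchange hd htt' ht'.1.2 (by simpa using hjA.1) ?_ ?_, hagree _ _ htt', ?_, ?_⟩
    · refine (Finset.card_le_card (t := insert j (S t)) fun i hi => ?_).trans
        ((Finset.card_insert_le _ _).trans hidle)
      rw [mem_interchange] at hi
      by_cases hij : i = j <;> simp_all
    · refine (Finset.card_le_card (t := S t') fun i hi => ?_).trans (hS.1 t')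
      rw [mem_interchange] at hi
      by_cases hij : i = j <;> simp_all
    · simp [mem_interchange, ht'.2]
    · intro i _ hi
      have hij : i ≠ j := fun he => hjS (he ▸ hi)
      simp [mem_interchange, hij, hi]
  · obtain ⟨k, hkS, hkL⟩ : ∃ k ∈ S t, k ∉ llfSched J m t := by
      by_contra! hsub
      have h1 := Finset.card_lt_card
        (Finset.ssubset_iff_of_subset hsub |>.2 ⟨j, hj, hjS⟩)
      have h2 : (llfSched J m t).card ≤ m :=
        card_select_le (llfLt_iff J _ t) (llfKey_injective J _ t)
      omega
    have hlax := curLax_le_of_llfKey_le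
      (le_of_mem_select (llfLt_iff J _ t) hj (hS.subset_llfActive hd ht h hkS) hkL)
    have hkc := hS.llfCnt_add_card hd ht h k
    simp only [curLax, hd] at hlax
    obtain ⟨t', ht', hjt', hkt'⟩ : ∃ t' ∈ Finset.Ico t d, j ∈ S t' ∧ k ∉ S t' := by
      by_contra! hall
      have hlt : ((Finset.Ico t d).filter fun s => j ∈ S s).card <
          ((Finset.Ico t d).filter fun s => k ∈ S s).card := by
        refine Finset.card_lt_card ((Finset.ssubset_iff_of_subset ?_).2 ⟨t, ?_, ?_⟩)
        · intro s hs
          rw [Finset.mem_filter] at hs ⊢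
          exact ⟨hs.1, hall s hs.1 hs.2⟩
        · simp [ht, hkS]
        · simp [hjS]
      omega
    rw [Finset.mem_Ico] at ht'
    have htt' : t < t' := lt_of_le_of_ne ht'.1 fun he => hjS (he ▸ hjt')
    have hjk : j ≠ k := fun he => hjS (he ▸ hkS)
    have hswap : ∀ s a b, a ∈ S s → (insert b ((S s).erase a)).card ≤ m := fun s a b ha => by
      have h1 := Finset.card_insert_le b ((S s).erase a)
      have h2 := Finset.card_erase_add_one ha
      have h3 := hS.1 s
      omega
    refine ⟨_root_.interchange S {j, k} t t',
      hS.interchange hd htt' ht'.2 ?_ ?_ ?_, hagree _ _ htt', ?_, ?_⟩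
    · simpa using ⟨hjA.1, (hS.2.1 t k hkS).1⟩
    · refine (Finset.card_le_card fun i hi => ?_).trans (hswap t k j hkS)
      rw [mem_interchange] at hi
      by_cases hij : i = j <;> by_cases hik : i = k <;> simp_all
    · refine (Finset.card_le_card fun i hi => ?_).trans (hswap t' j k hjt')
      rw [mem_interchange] at hi
      by_cases hij : i = j <;> by_cases hik : i = k <;> simp_all
    · simp [mem_interchange, hjt']
    · intro i hiL hi
      have hij : i ≠ j := fun he => hjS (he ▸ hi)
      have hik : i ≠ k := fun he => hkL (he ▸ hiL)
      simp [mem_interchange, hij, hik, hi]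

theorem IsFeasibleSchedule.exists_agree_succ {n : ℕ} {J : Fin n → Job} {m d t : ℕ}
    {S : ℕ → Finset (Fin n)} (hS : IsFeasibleSchedule J m S) (hd : ∀ j, (J j).d = d)
    (ht : t < d) (h : ∀ s < t, S s = llfSched J m s) :
    ∃ S', IsFeasibleSchedule J m S' ∧ ∀ s < t + 1, S' s = llfSched J m s := by
  induction hN : (llfSched J m t \ S t).card using Nat.strong_induction_on generalizing S with
  | _ N ih =>
    by_cases hsub : llfSched J m t ⊆ S t
    · refine ⟨S, hS, fun s hs => ?_⟩
      rcases Nat.lt_succ_iff_lt_or_eq.1 hs with hs | rfl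
      · exact h s hs
      refine (Finset.Subset.antisymm hsub fun k hk => ?_).symm
      by_contra hkL
      have h1 := Finset.card_lt_card (Finset.ssubset_iff_of_subset hsub |>.2 ⟨k, hk, hkL⟩)
      have h2 : m ≤ (llfSched J m s).card :=
        le_card_select (llfLt_iff J _ s) (hS.subset_llfActive hd ht h hk) hkL
      have h3 := hS.1 s
      omega
    · obtain ⟨j, hj, hjS⟩ := Finset.not_subset.1 hsub
      obtain ⟨S', hS', hagree, hjS', hmono⟩ := hS.exists_exchange hd ht h hj hjS
      refine ih _ ?_ hS' hagree rfl
      rw [← hN]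
      refine Finset.card_lt_card ((Finset.ssubset_iff_of_subset ?_).2 ⟨j, ?_, ?_⟩)
      · intro i hi
        rw [Finset.mem_sdiff] at hi ⊢
        exact ⟨hi.1, fun hiS => hi.2 (hmono i hi.1 hiS)⟩
      · simp [hj, hjS]
      · simp [hjS']

theorem IsFeasibleSchedule.exists_agree {n : ℕ} {J : Fin n → Job} {m d : ℕ}
    {S : ℕ → Finset (Fin n)} (hS : IsFeasibleSchedule J m S) (hd : ∀ j, (J j).d = d)
    {t : ℕ} (ht : t ≤ d) :
    ∃ S', IsFeasibleSchedule J m S' ∧ ∀ s < t, S' s = llfSched J m s := by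
  induction t with
  | zero => exact ⟨S, hS, by simp⟩
  | succ t ih =>
    obtain ⟨S', hS', h⟩ := ih (by omega)
    exact hS'.exists_agree_succ hd ht h

/-- If all jobs have the same deadline `d` and `J` admits a feasible
preemptive schedule on `m` machines, then the LLF schedule of `J` on `m` machines
completes every job by its deadline. -/
theorem llf_uniform_deadline_optimal {n : ℕ} (J : Fin n → Job)
    (hval : ∀ j, (J j).valid)
    (d : ℕ) (hd : ∀ j, (J j).d = d)
    (m : ℕ) (hm : FeasiblePre J m) :
    ∀ j, ((Finset.Ico (J j).r (J j).d).filter (fun t => j ∈ llfSched J m t)).card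
      = (J j).p := by
  obtain ⟨S, hS⟩ := hm
  obtain ⟨S', hS', h⟩ := IsFeasibleSchedule.exists_agree hS hd le_rfl
  intro j
  rw [← hS'.2.2 j]
  congr 1
  ext t
  simp only [Finset.mem_filter, Finset.mem_Ico, Finset.mem_range]
  constructor
  · rintro ⟨⟨-, ht⟩, hj⟩
    exact ⟨ht, by rwa [h t (hd j ▸ ht)]⟩
  · rintro ⟨ht, hj⟩
    exact ⟨⟨(hS'.2.1 t j hj).1, ht⟩, by rwa [← h t (hd j ▸ ht)]⟩
end
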